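/- Minimax lower bound in Wasserstein-1 distance: Fix d ≥ 3 and β > 0. There exist K₀ ≥ 1 and c > 0, depending only on d and β, such that for every K ≥ K₀ and every n ∈ ℕ*, and for every estimator — i.e., every measurable assignment (x₁,…,x_n) ↦ p̂_n(x₁,…,x_n) of a probability measure on ℝ^d with finite first moment to each sample in (ℝ^d)^n — one has sup_{p⋆ ∈ A^β_K} E_{(X₁,…,X_n) i.i.d. ∼ p⋆}[ W₁(p⋆·Leb, p̂_n(X₁,…,X_n)) ] ≥ c·n^{−(β+1)/(2β+d)}. -/

import Mathlib

open MeasureTheory Real Set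

noncomputable section

/-- `ℝ^d` with the Euclidean structure. -/
abbrev Euc (d : ℕ) := EuclideanSpace ℝ (Fin d)

/-- `p` is a probability density on `ℝ^d`. -/
def IsProbDensity (d : ℕ) (p : Euc d → ℝ) : Prop :=
  (∀ x, 0 ≤ p x) ∧ Measurable p ∧ (∫ x, p x) = 1

/-- 1-Wasserstein distance between two measures on `ℝ^d`, in dual
(Kantorovich–Rubinstein) form: `W₁(P,Q) = sup_{f 1-Lipschitz} ∫ f dP - ∫ f dQ`. -/
def W1 {d : ℕ} (P Q : Measure (Euc d)) : ℝ :=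
  ⨆ f : {f : Euc d → ℝ // LipschitzWith 1 f}, ((∫ x, f.1 x ∂P) - ∫ x, f.1 x ∂Q)

/-- Membership in the Hölder ball of regularity `η` and radius `K` on the set `X`:
`f` is `⌊η⌋`-times continuously differentiable on `X`, and the sum of the sup-norms of
its derivatives up to order `⌊η⌋` plus the `(η - ⌊η⌋)`-Hölder seminorm of the `⌊η⌋`-th
derivative is at most `K`. -/
def MemHolderBall {E F : Type*} [NormedAddCommGroup E] [NormedSpace ℝ E]
    [NormedAddCommGroup F] [NormedSpace ℝ F]
    (η K : ℝ) (X : Set E) (f : E → F) : Prop :=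
  ContDiffOn ℝ (⌊η⌋₊ : ℕ) f X ∧
  ∃ (M : ℕ → ℝ) (H : ℝ),
    (∀ k ≤ ⌊η⌋₊, ∀ x ∈ X, ‖iteratedFDerivWithin ℝ k f X x‖ ≤ M k) ∧
    (∀ x ∈ X, ∀ y ∈ X,
      ‖iteratedFDerivWithin ℝ ⌊η⌋₊ f X x - iteratedFDerivWithin ℝ ⌊η⌋₊ f X y‖
        ≤ H * ‖x - y‖ ^ (η - (⌊η⌋₊ : ℝ))) ∧
    (∑ k ∈ Finset.range (⌊η⌋₊ + 1), M k) + H ≤ K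

/-- **Assumption 1** of the paper: `p = exp(-u + a)` on its support, with `a`
in the Hölder ball `H^β_K`, `u` of class `C^{1 + max(1, ⌊β⌋)}`, `∇²u ⪰ K⁻¹ I`,
`‖argmin u‖ ≤ K`, and a tempered-growth condition on the derivatives of `u`.
Membership is written `p ∈ A^β_K` in the paper. -/
def Assumption1 (d : ℕ) (β K : ℝ) (p : Euc d → ℝ) : Prop :=
  IsProbDensity d p ∧
  ∃ u a : Euc d → ℝ,
    (∀ x ∈ Function.support p, p x = Real.exp (-u x + a x)) ∧
    -- (1) regularity
    MemHolderBall β K (Function.support p) a ∧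
    ContDiffOn ℝ ((1 + max 1 ⌊β⌋₊ : ℕ)) u (Function.support p) ∧
    -- (2) strong convexity: ∇²u ⪰ K⁻¹ I on the support
    (∀ x ∈ Function.support p, ∀ v : Euc d,
      K⁻¹ * ‖v‖ ^ 2 ≤ iteratedFDerivWithin ℝ 2 u (Function.support p) x ![v, v]) ∧
    -- (3) the minimizer of u lies in B(0, K)
    (∃ xmin ∈ Function.support p,
      (∀ y ∈ Function.support p, u xmin ≤ u y) ∧ ‖xmin‖ ≤ K) ∧
    -- (4) tempered growth of the derivatives of u
    (∀ x ∈ Function.support p, ∀ y ∈ Function.support p,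
      ‖x - y‖ ≤ (K * max 1 |u x|) ^ (-K) →
      ∀ k ≤ ⌊β⌋₊ + 1,
        ‖iteratedFDerivWithin ℝ k u (Function.support p) y‖ ≤ K * (1 + |u x| ^ K))


/-- sign of a boolean -/
def sgnB (b : Bool) : ℝ := if b then 1 else -1

lemma sgnB_not (b : Bool) : sgnB (!b) = - sgnB b := by cases b <;> simp [sgnB]

lemma abs_sgnB (b : Bool) : |sgnB b| = 1 := by cases b <;> simp [sgnB]

def flipB {J : Type*} [DecidableEq J] (j : J) (σ : J → Bool) : J → Bool :=
  Function.update σ j (!(σ j))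

lemma flipB_flipB {J : Type*} [DecidableEq J] (j : J) (σ : J → Bool) :
    flipB j (flipB j σ) = σ := by
  simp [flipB]

lemma assouad {J Ω : Type*} [Fintype J] [DecidableEq J] [MeasurableSpace Ω] (μ : Measure Ω)
    (ρ : (J → Bool) → Ω → ℝ) (hρ0 : ∀ σ ω, 0 ≤ ρ σ ω) (hρm : ∀ σ, Measurable (ρ σ))
    (hρi : ∀ σ, Integrable (ρ σ) μ)
    (W : (J → Bool) → Ω → ℝ) (hW : ∀ σ, Measurable (W σ)) (Θ : ℝ) (hΘ : 0 ≤ Θ)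
    (L : J → Ω → ℝ) (hWL : ∀ σ ω, ∑ j, |sgnB (σ j) * Θ - L j ω| ≤ W σ ω)
    (α : ℝ) (haff : ∀ σ j, α ≤ ∫ ω, min (ρ σ ω) (ρ (flipB j σ) ω) ∂μ) :
    ∃ σ, ENNReal.ofReal (Fintype.card J * Θ * α) ≤
      ∫⁻ ω, ENNReal.ofReal (W σ ω) ∂(μ.withDensity fun ω => ENNReal.ofReal (ρ σ ω)) := by
  have hW0 : ∀ σ ω, 0 ≤ W σ ω := fun σ ω =>
    le_trans (Finset.sum_nonneg fun j _ => abs_nonneg _) (hWL σ ω)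
  have hmi : ∀ σ j, Integrable (fun ω => min (ρ σ ω) (ρ (flipB j σ) ω)) μ :=
    fun σ j => (hρi σ).inf (hρi _)
  have pt : ∀ ω, ∑ σ, ∑ j, Θ * min (ρ σ ω) (ρ (flipB j σ) ω) ≤ ∑ σ, ρ σ ω * W σ ω := by
    intro ω
    have h1 : ∑ σ, ∑ j, ρ σ ω * |sgnB (σ j) * Θ - L j ω| ≤ ∑ σ, ρ σ ω * W σ ω := by
      refine Finset.sum_le_sum fun σ _ => ?_
      rw [← Finset.mul_sum]
      exact mul_le_mul_of_nonneg_left (hWL σ ω) (hρ0 σ ω)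
    refine le_trans ?_ h1
    rw [Finset.sum_comm (f := fun σ j => Θ * min (ρ σ ω) (ρ (flipB j σ) ω)),
      Finset.sum_comm (f := fun (σ : J → Bool) j => ρ σ ω * |sgnB (σ j) * Θ - L j ω|)]
    refine Finset.sum_le_sum fun j _ => ?_
    have h2 : ∑ σ : J → Bool, ρ σ ω * |sgnB (σ j) * Θ - L j ω|
        = ∑ σ : J → Bool, ρ (flipB j σ) ω * |sgnB ((flipB j σ) j) * Θ - L j ω| := by
      refine (Equiv.sum_comp (Function.Involutive.toPerm (flipB j) (flipB_flipB j))
        (fun σ : J → Bool => ρ σ ω * |sgnB (σ j) * Θ - L j ω|)).symm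
    have h3 : ∑ σ : J → Bool, 2 * (Θ * min (ρ σ ω) (ρ (flipB j σ) ω)) ≤
        ∑ σ : J → Bool, (ρ σ ω * |sgnB (σ j) * Θ - L j ω| +
          ρ (flipB j σ) ω * |sgnB ((flipB j σ) j) * Θ - L j ω|) := by
      refine Finset.sum_le_sum fun σ _ => ?_
      have e : sgnB ((flipB j σ) j) = - sgnB (σ j) := by simp [flipB, sgnB_not]
      rw [e]
      set A := ρ σ ω
      set B := ρ (flipB j σ) ω
      have hA : 0 ≤ A := hρ0 _ _
      have hB : 0 ≤ B := hρ0 _ _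
      have hm : 0 ≤ min A B := le_min hA hB
      have t : 2 * Θ ≤ |sgnB (σ j) * Θ - L j ω| + |-sgnB (σ j) * Θ - L j ω| := by
        have := abs_sub (sgnB (σ j) * Θ - L j ω) (-sgnB (σ j) * Θ - L j ω)
        have e2 : sgnB (σ j) * Θ - L j ω - (-sgnB (σ j) * Θ - L j ω) = sgnB (σ j) * (2 * Θ) := by
          ring
        rw [e2, abs_mul, abs_sgnB, one_mul, abs_of_nonneg (by positivity)] at this
        exact this
      have a1 := mul_le_mul_of_nonneg_right (min_le_left A B) (abs_nonneg (sgnB (σ j) * Θ - L j ω))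
      have a2 := mul_le_mul_of_nonneg_right (min_le_right A B)
        (abs_nonneg (-sgnB (σ j) * Θ - L j ω))
      have a3 := mul_le_mul_of_nonneg_left t hm
      nlinarith
    rw [Finset.sum_add_distrib, ← h2, ← Finset.mul_sum] at h3
    linarith
  by_contra hcon
  push Not at hcon
  have hsum := ENNReal.sum_lt_sum_of_nonempty (s := (Finset.univ : Finset (J → Bool)))
    Finset.univ_nonempty (fun σ _ => hcon σ)
  have key : ∑ σ : J → Bool, ENNReal.ofReal (Fintype.card J * Θ * α) ≤
      ∑ σ, ∫⁻ ω, ENNReal.ofReal (W σ ω) ∂(μ.withDensity fun ω => ENNReal.ofReal (ρ σ ω)) := by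
    have e1 : ∀ σ, ∫⁻ ω, ENNReal.ofReal (W σ ω) ∂(μ.withDensity fun ω => ENNReal.ofReal (ρ σ ω))
        = ∫⁻ ω, ENNReal.ofReal (ρ σ ω * W σ ω) ∂μ := by
      intro σ
      rw [lintegral_withDensity_eq_lintegral_mul _ (hρm σ).ennreal_ofReal (hW σ).ennreal_ofReal]
      refine lintegral_congr fun ω => ?_
      simp only [Pi.mul_apply]
      rw [ENNReal.ofReal_mul (hρ0 σ ω)]
    simp_rw [e1]
    have hmm : ∀ σ, Measurable fun ω => ENNReal.ofReal (ρ σ ω * W σ ω) :=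
      fun σ => ((hρm σ).mul (hW σ)).ennreal_ofReal
    rw [← lintegral_finsetSum _ (fun σ _ => hmm σ)]
    have e2 : ∀ ω, ∑ σ, ENNReal.ofReal (ρ σ ω * W σ ω) = ENNReal.ofReal (∑ σ, ρ σ ω * W σ ω) :=
      fun ω => (ENNReal.ofReal_sum_of_nonneg
        (fun σ _ => mul_nonneg (hρ0 σ ω) (hW0 σ ω))).symm
    simp_rw [e2]
    have hIntg : Integrable (fun ω => ∑ σ, ∑ j, Θ * min (ρ σ ω) (ρ (flipB j σ) ω)) μ :=
      integrable_finsetSum _ fun σ _ => integrable_finsetSum _ fun j _ => (hmi σ j).const_mul Θ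
    calc ∑ σ : J → Bool, ENNReal.ofReal (Fintype.card J * Θ * α)
        = ENNReal.ofReal (∑ σ : J → Bool, ∑ j : J, Θ * α) := by
          simp only [Finset.sum_const, Finset.card_univ, nsmul_eq_mul]
          rw [ENNReal.ofReal_mul (p := (Fintype.card (J → Bool) : ℝ)) (by positivity),
            ENNReal.ofReal_natCast, mul_assoc (Fintype.card J : ℝ)]
      _ ≤ ENNReal.ofReal (∫ ω, ∑ σ, ∑ j, Θ * min (ρ σ ω) (ρ (flipB j σ) ω) ∂μ) := by
          apply ENNReal.ofReal_le_ofReal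
          rw [integral_finsetSum _ (fun σ _ => integrable_finsetSum _ fun j _ =>
            (hmi σ j).const_mul Θ)]
          refine Finset.sum_le_sum fun σ _ => ?_
          rw [integral_finsetSum _ (fun j _ => (hmi σ j).const_mul Θ)]
          refine Finset.sum_le_sum fun j _ => ?_
          rw [integral_const_mul]
          exact mul_le_mul_of_nonneg_left (haff σ j) hΘ
      _ = ∫⁻ ω, ENNReal.ofReal (∑ σ, ∑ j, Θ * min (ρ σ ω) (ρ (flipB j σ) ω)) ∂μ := by
          apply ofReal_integral_eq_lintegral_ofReal hIntg
          exact Filter.Eventually.of_forall fun ω => Finset.sum_nonneg fun σ _ =>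
            Finset.sum_nonneg fun j _ => mul_nonneg hΘ (le_min (hρ0 _ _) (hρ0 _ _))
      _ ≤ _ := lintegral_mono fun ω => ENNReal.ofReal_le_ofReal (pt ω)
  exact absurd hsum (not_lt.mpr key)

lemma pi_withDensity_ofReal {X : Type*} [MeasurableSpace X] (μ : Measure X) [IsFiniteMeasure μ]
    (n : ℕ) (f : X → ℝ) (hf0 : ∀ x, 0 ≤ f x) (hf : Integrable f μ) :
    Measure.pi (fun _ : Fin n => μ.withDensity fun x => ENNReal.ofReal (f x)) =
      (Measure.pi fun _ : Fin n => μ).withDensity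
        (fun ω => ENNReal.ofReal (∏ i, f (ω i))) := by
  have : IsFiniteMeasure (μ.withDensity fun x => ENNReal.ofReal (f x)) :=
    isFiniteMeasure_withDensity_ofReal hf.2
  refine Measure.pi_eq fun s hs => ?_
  have hS : MeasurableSet (Set.univ.pi s) := MeasurableSet.univ_pi hs
  rw [withDensity_apply _ hS, ← lintegral_indicator hS]
  have e : ∀ ω : Fin n → X, (Set.univ.pi s).indicator
      (fun ω => ENNReal.ofReal (∏ i, f (ω i))) ω =
      ENNReal.ofReal (∏ i, (s i).indicator f (ω i)) := by
    intro ω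
    by_cases h : ω ∈ Set.univ.pi s
    · rw [indicator_of_mem h]
      congr 1
      refine Finset.prod_congr rfl fun i _ => ?_
      rw [indicator_of_mem (h i (mem_univ i))]
    · rw [indicator_of_notMem h]
      have : ∃ i, ω i ∉ s i := by simpa [Set.mem_pi] using h
      obtain ⟨i, hi⟩ := this
      rw [Finset.prod_eq_zero (Finset.mem_univ i) (indicator_of_notMem hi f)]
      simp
  simp_rw [e]
  have hin : ∀ i, Integrable ((s i).indicator f) μ := fun i => hf.indicator (hs i)
  have hn : ∀ i x, 0 ≤ (s i).indicator f x := fun i x => indicator_nonneg (fun x _ => hf0 x) x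
  rw [← ofReal_integral_eq_lintegral_ofReal (Integrable.fintype_prod hin)
    (Filter.Eventually.of_forall fun ω => Finset.prod_nonneg fun i _ => hn i (ω i)),
    integral_fintype_prod_eq_prod (fun i => (s i).indicator f), ENNReal.ofReal_prod_of_nonneg]
  · refine Finset.prod_congr rfl fun i _ => ?_
    rw [withDensity_apply _ (hs i), ← lintegral_indicator (hs i),
      ofReal_integral_eq_lintegral_ofReal (hin i) (Filter.Eventually.of_forall (hn i))]
    refine lintegral_congr fun x => ?_
    by_cases h : x ∈ s i <;> simp [h]
  · intro i _
    exact integral_nonneg (hn i)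

lemma affinity {X : Type*} [MeasurableSpace X] (μ : Measure X) [IsFiniteMeasure μ]
    (n : ℕ) (p q : X → ℝ) (hp0 : ∀ x, 0 ≤ p x) (hq0 : ∀ x, 0 ≤ q x)
    (hpm : Measurable p) (hqm : Measurable q)
    (hp : Integrable p μ) (hq : Integrable q μ) (hp1 : ∫ x, p x ∂μ = 1) (hq1 : ∫ x, q x ∂μ = 1)
    (δ : ℝ) (hδ : ∫ x, ((p x + q x) / 2 - √(p x * q x)) ∂μ ≤ δ) (hδ1 : δ ≤ 1)
    (hn : n * δ ≤ 1 / 2) :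
    1 / 8 ≤ ∫ ω, min (∏ i, p (ω i)) (∏ i, q (ω i)) ∂(Measure.pi fun _ : Fin n => μ) := by
  set r : X → ℝ := fun x => √(p x * q x) with hr
  have hrm : Measurable r := (hpm.mul hqm).sqrt
  have hri : Integrable r μ := by
    refine Integrable.mono' (hp.add hq) hrm.aestronglyMeasurable
      (Filter.Eventually.of_forall fun x => ?_)
    rw [Real.norm_eq_abs, abs_of_nonneg (Real.sqrt_nonneg _)]
    apply Real.sqrt_le_iff.2
    have := hp0 x
    have := hq0 x
    simp only [Pi.add_apply]
    exact ⟨by positivity, by nlinarith [mul_nonneg (hp0 x) (hq0 x)]⟩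
  have hb : 1 - δ ≤ ∫ x, r x ∂μ := by
    have hpq : Integrable (fun x => (p x + q x) / 2) μ := (hp.add hq).div_const 2
    rw [integral_sub hpq hri, integral_div, integral_add hp hq, hp1, hq1] at hδ
    linarith
  have hbn : 1 / 2 ≤ (∫ x, r x ∂μ) ^ n := by
    have h1 := one_add_mul_le_pow (a := -δ) (by linarith) n
    have h2 : (1 + -δ) ^ n ≤ (∫ x, r x ∂μ) ^ n := pow_le_pow_left₀ (by linarith) (by linarith) n
    linarith
  have hP : Integrable (fun ω : Fin n → X => ∏ i, p (ω i)) (Measure.pi fun _ : Fin n => μ) :=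
    Integrable.fintype_prod (fun _ => hp)
  have hQ : Integrable (fun ω : Fin n → X => ∏ i, q (ω i)) (Measure.pi fun _ : Fin n => μ) :=
    Integrable.fintype_prod (fun _ => hq)
  have hR : Integrable (fun ω : Fin n → X => ∏ i, r (ω i)) (Measure.pi fun _ : Fin n => μ) :=
    Integrable.fintype_prod (fun _ => hri)
  have hle : ∫ ω, ((1/2) * (∏ i, r (ω i)) - (1/16) * (∏ i, p (ω i) + ∏ i, q (ω i)))
      ∂(Measure.pi fun _ : Fin n => μ) ≤
      ∫ ω, min (∏ i, p (ω i)) (∏ i, q (ω i)) ∂(Measure.pi fun _ : Fin n => μ) := by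
    refine integral_mono ((hR.const_mul _).sub ((hP.add hQ).const_mul _)) (hP.inf hQ) fun ω => ?_
    have e : (∏ i, r (ω i)) ^ 2 = (∏ i, p (ω i)) * ∏ i, q (ω i) := by
      rw [← Finset.prod_pow, ← Finset.prod_mul_distrib]
      refine Finset.prod_congr rfl fun i _ => ?_
      exact Real.sq_sqrt (mul_nonneg (hp0 _) (hq0 _))
    have hR0 : 0 ≤ ∏ i, r (ω i) := Finset.prod_nonneg fun i _ => Real.sqrt_nonneg _
    have hP0 : 0 ≤ ∏ i, p (ω i) := Finset.prod_nonneg fun i _ => hp0 _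
    have hQ0 : 0 ≤ ∏ i, q (ω i) := Finset.prod_nonneg fun i _ => hq0 _
    simp only
    generalize (∏ i, r (ω i)) = R at *
    generalize (∏ i, p (ω i)) = P at *
    generalize (∏ i, q (ω i)) = Q at *
    have hR2 : R / 2 ≤ P + Q / 16 := by
      apply le_of_sq_le_sq _ (by positivity)
      nlinarith [sq_nonneg (P - Q / 16)]
    have hR3 : R / 2 ≤ Q + P / 16 := by
      apply le_of_sq_le_sq _ (by positivity)
      nlinarith [sq_nonneg (Q - P / 16)]
    apply le_min <;> linarith
  have hPQ : Integrable (fun ω : Fin n → X => (1/16) * (∏ i, p (ω i) + ∏ i, q (ω i)))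
    (Measure.pi fun _ : Fin n => μ) := (hP.add hQ).const_mul _
  rw [integral_sub (hR.const_mul _) hPQ, integral_const_mul,
    integral_const_mul, integral_add hP hQ, integral_fintype_prod_eq_pow,
    integral_fintype_prod_eq_pow, integral_fintype_prod_eq_pow, hp1, hq1] at hle
  simp only [Fintype.card_fin, one_pow] at hle
  linarith

lemma exists_phi (d : ℕ) (hd : 0 < d) : ∃ φ : Euc d → ℝ, (∀ n : ℕ, ContDiff ℝ n φ) ∧
    (∀ x, φ (-x) = - φ x) ∧ (∀ x, 1 / 4 ≤ ‖x‖ → φ x = 0) ∧ (∀ x, |φ x| ≤ 1) ∧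
    0 < ∫ x, φ x ^ 2 := by
  let f : ContDiffBump (0 : Euc d) := ⟨1/8, 1/4, by norm_num, by norm_num⟩
  let i0 : Fin d := ⟨0, hd⟩
  have hz : ∀ x : Euc d, 1 / 4 ≤ ‖x‖ → x i0 * f x = 0 := fun x hx => by
    rw [f.zero_of_le_dist (by simpa [dist_zero_right, f] using hx), mul_zero]
  have hc : ∀ n : ℕ, ContDiff ℝ n (fun x : Euc d => x i0 * f x) := fun n =>
    (contDiff_euclidean.1 contDiff_id i0).mul f.contDiff
  refine ⟨fun x => x i0 * f x, hc, ?_, hz, ?_, ?_⟩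
  · intro x
    simp only [f.neg]; simp
  · intro x
    by_cases hx : 1 / 4 ≤ ‖x‖
    · simp only [hz x hx]; norm_num
    · rw [abs_mul]
      have h1 : |x i0| ≤ ‖x‖ := by simpa using PiLp.norm_apply_le x i0
      have h2 : |f x| ≤ 1 := by rw [abs_of_nonneg f.nonneg]; exact f.le_one
      nlinarith [abs_nonneg (x i0), abs_nonneg (f x)]
  · have hcont : Continuous (fun x : Euc d => (x i0 * f x) ^ 2) := (hc 0).continuous.pow 2
    have hcs : HasCompactSupport (fun x : Euc d => (x i0 * f x) ^ 2) := by
      refine HasCompactSupport.intro (isCompact_closedBall (0 : Euc d) (1/4)) fun x hx => ?_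
      have : 1 / 4 ≤ ‖x‖ := by
        simp at hx; norm_num; linarith
      simp only [hz x this]; norm_num
    refine hcont.integral_pos_of_hasCompactSupport_nonneg_nonzero hcs (fun x => sq_nonneg _)
      (x := EuclideanSpace.single i0 (16⁻¹ : ℝ)) ?_
    have : 0 < f (EuclideanSpace.single i0 (16⁻¹ : ℝ)) := by
      apply f.pos_of_mem_ball
      simp [f]; norm_num [abs_of_pos]
    simp
    exact this.ne'

lemma holder_of_bdd {E : Type*} [NormedAddCommGroup E] [NormedSpace ℝ E] (f : E → ℝ)
    (hf : ∀ n : ℕ, ContDiff ℝ n f) (S : Set E) (hS : Convex ℝ S)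
    (hb : ∀ k, ∃ C, ∀ x ∈ S, ‖iteratedFDeriv ℝ k f x‖ ≤ C) (s : ℝ) (hs0 : 0 ≤ s) (hs1 : s ≤ 1)
    (k : ℕ) : ∃ C, 0 ≤ C ∧ (∀ x ∈ S, ‖iteratedFDeriv ℝ k f x‖ ≤ C) ∧ ∀ x ∈ S, ∀ y ∈ S,
      ‖iteratedFDeriv ℝ k f x - iteratedFDeriv ℝ k f y‖ ≤ C * ‖x - y‖ ^ s := by
  obtain ⟨C0, h0⟩ := hb k
  obtain ⟨C1, h1⟩ := hb (k + 1)
  have hlip : ∀ x ∈ S, ∀ y ∈ S,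
      ‖iteratedFDeriv ℝ k f x - iteratedFDeriv ℝ k f y‖ ≤ C1 * ‖x - y‖ := by
    intro x hx y hy
    refine hS.norm_image_sub_le_of_norm_fderiv_le (𝕜 := ℝ) (fun z _ => ?_) (fun z hz => ?_) hy hx
    · exact ((hf (k+1)).differentiable_iteratedFDeriv (by exact_mod_cast Nat.lt_succ_self k)) z
    · rw [norm_fderiv_iteratedFDeriv]; exact h1 z hz
  refine ⟨2 * |C0| + |C1|, by positivity, fun x hx => ?_, fun x hx y hy => ?_⟩
  · have := h0 x hx
    have := le_abs_self C0
    have := abs_nonneg C1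
    have := abs_nonneg C0
    linarith
  · rcases le_total ‖x - y‖ 1 with h | h
    · have h2 : ‖x - y‖ ≤ ‖x - y‖ ^ s := by
        rcases eq_or_lt_of_le (norm_nonneg (x - y)) with h3 | h3
        · rw [← h3]; positivity
        · calc ‖x - y‖ = ‖x - y‖ ^ (1:ℝ) := (rpow_one _).symm
            _ ≤ _ := rpow_le_rpow_of_exponent_ge h3 h hs1
      calc _ ≤ C1 * ‖x - y‖ := hlip x hx y hy
        _ ≤ (2 * |C0| + |C1|) * ‖x - y‖ := by
            have := le_abs_self C1
            have := abs_nonneg C0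
            gcongr; linarith
        _ ≤ _ := by gcongr
    · have h2 : 1 ≤ ‖x - y‖ ^ s := one_le_rpow h hs0
      have h3 := norm_sub_le (iteratedFDeriv ℝ k f x) (iteratedFDeriv ℝ k f y)
      have := h0 x hx
      have := h0 y hy
      have := le_abs_self C0
      calc _ ≤ (2 * |C0| + |C1|) * 1 := by
            have := abs_nonneg C1
            linarith
        _ ≤ _ := by gcongr

lemma bdd_ball {d : ℕ} (f : Euc d → ℝ) (hf : ∀ n : ℕ, ContDiff ℝ n f) (R : ℝ) (k : ℕ) :
    ∃ C, ∀ x ∈ Metric.ball (0 : Euc d) R, ‖iteratedFDeriv ℝ k f x‖ ≤ C := by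
  obtain ⟨C, hC⟩ := (isCompact_closedBall (0 : Euc d) R).exists_bound_of_continuousOn
    ((hf k).continuous_iteratedFDeriv le_rfl).continuousOn
  exact ⟨C, fun x hx => hC x (Metric.ball_subset_closedBall hx)⟩

lemma tsupp_phi {d : ℕ} (f : Euc d → ℝ) (h : ∀ x, 1 / 4 ≤ ‖x‖ → f x = 0) :
    tsupport f ⊆ Metric.closedBall 0 (1/4) := by
  apply closure_minimal _ Metric.isClosed_closedBall
  intro x hx
  by_contra h2
  apply hx
  apply h
  simp at h2; norm_num; linarith

lemma bdd_univ {d : ℕ} (f : Euc d → ℝ) (hf : ∀ n : ℕ, ContDiff ℝ n f)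
    (h : ∀ x, 1 / 4 ≤ ‖x‖ → f x = 0) (k : ℕ) :
    ∃ C, ∀ x ∈ (univ : Set (Euc d)), ‖iteratedFDeriv ℝ k f x‖ ≤ C := by
  have hcs : HasCompactSupport f := by
    refine HasCompactSupport.intro (isCompact_closedBall (0 : Euc d) (1/4)) fun x hx => ?_
    apply h
    simp at hx; norm_num; linarith
  obtain ⟨C, hC⟩ := (hcs.iteratedFDeriv (𝕜 := ℝ) k).exists_bound_of_continuous
    ((hf k).continuous_iteratedFDeriv le_rfl)
  exact ⟨C, fun x _ => hC x⟩

lemma sum_disjoint_diff {J F : Type*} [Fintype J] [NormedAddCommGroup F] [NormedSpace ℝ F]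
    (c : J → ℝ) (hc : ∀ j, |c j| ≤ 1) (G G' : J → F)
    (hG : ∀ i j, G i ≠ 0 → G j ≠ 0 → i = j) (hG' : ∀ i j, G' i ≠ 0 → G' j ≠ 0 → i = j)
    (C : ℝ) (hC : 0 ≤ C) (h : ∀ j, ‖G j - G' j‖ ≤ C) :
    ‖∑ j, c j • G j - ∑ j, c j • G' j‖ ≤ 2 * C := by
  classical
  rw [← Finset.sum_sub_distrib]
  set s : Finset J := Finset.univ.filter (fun j => G j ≠ 0) ∪ Finset.univ.filter (fun j => G' j ≠ 0)
  have hs : s.card ≤ 2 := by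
    refine (Finset.card_union_le _ _).trans ?_
    have h1 : (Finset.univ.filter (fun j => G j ≠ 0)).card ≤ 1 :=
      Finset.card_le_one.2 (by simpa using fun i hi j hj => hG i j hi hj)
    have h2 : (Finset.univ.filter (fun j => G' j ≠ 0)).card ≤ 1 :=
      Finset.card_le_one.2 (by simpa using fun i hi j hj => hG' i j hi hj)
    omega
  have e : ∑ j, (c j • G j - c j • G' j) = ∑ j ∈ s, (c j • G j - c j • G' j) := by
    symm
    apply Finset.sum_subset (Finset.subset_univ _)
    intro j _ hj
    have : G j = 0 ∧ G' j = 0 := by simpa [s] using hj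
    rw [this.1, this.2]; simp
  rw [e]
  calc ‖∑ j ∈ s, (c j • G j - c j • G' j)‖ ≤ ∑ j ∈ s, C := by
        refine norm_sum_le_of_le _ fun j _ => ?_
        rw [← smul_sub, norm_smul, Real.norm_eq_abs]
        have := mul_le_mul (hc j) (h j) (norm_nonneg _) zero_le_one
        linarith
    _ = s.card * C := by simp
    _ ≤ 2 * C := by
        have : (s.card : ℝ) ≤ 2 := by exact_mod_cast hs
        gcongr

def kap (d N : ℕ) (j : Fin d → Fin N) : Euc d := WithLp.toLp 2 fun i => (((j i : ℕ)) : ℝ)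

lemma kap_sep {d N : ℕ} (i j : Fin d → Fin N) (h : ‖kap d N i - kap d N j‖ < 1) : i = j := by
  funext a
  have h1 := PiLp.norm_apply_le (kap d N i - kap d N j) a
  have h2 : |((i a : ℕ) : ℝ) - ((j a : ℕ) : ℝ)| < 1 := by
    simpa [kap] using lt_of_le_of_lt h1 h
  have h3 : |((i a : ℕ) : ℤ) - ((j a : ℕ) : ℤ)| < 1 := by exact_mod_cast h2
  rw [Int.abs_lt_one_iff] at h3
  apply Fin.ext
  omega

lemma kap_norm {d N : ℕ} (j : Fin d → Fin N) : ‖kap d N j‖ ≤ d * N := by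
  have h1 : kap d N j = ∑ i : Fin d, EuclideanSpace.single i (((j i : ℕ)) : ℝ) := by
    ext a
    simp [kap, Finset.sum_apply, Pi.single_apply]
  rw [h1]
  calc _ ≤ ∑ i : Fin d, (N : ℝ) := by
        refine norm_sum_le_of_le _ fun i _ => ?_
        simp
    _ = _ := by simp

/-- rescaled bump -/
def gB {d : ℕ} (φ : Euc d → ℝ) (N : ℕ) (j : Fin d → Fin N) (x : Euc d) : ℝ :=
  φ ((N : ℝ) • x - kap d N j)

lemma iteratedFDeriv_gB {d : ℕ} (φ : Euc d → ℝ) (hf : ∀ n : ℕ, ContDiff ℝ n φ) (N : ℕ)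
    (j : Fin d → Fin N) (k : ℕ) (x : Euc d) :
    iteratedFDeriv ℝ k (gB φ N j) x =
      (N : ℝ) ^ k • iteratedFDeriv ℝ k φ ((N : ℝ) • x - kap d N j) := by
  have h := iteratedFDeriv_comp_const_smul (𝕜 := ℝ) (i := k) (f := fun y => φ (y - kap d N j))
    (N : ℝ) ((hf k).comp (contDiff_id.sub contDiff_const))
  have h2 := congrFun h x
  rw [iteratedFDeriv_comp_sub'] at h2
  exact h2

lemma near_sep {d N : ℕ} (i j : Fin d → Fin N) (y : Euc d) (hi : ‖y - kap d N i‖ ≤ 1 / 4)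
    (hj : ‖y - kap d N j‖ ≤ 1 / 4) : i = j := by
  apply kap_sep
  have : kap d N i - kap d N j = (y - kap d N j) - (y - kap d N i) := by abel
  rw [this]
  have := norm_sub_le (y - kap d N j) (y - kap d N i)
  linarith

lemma iteratedFDeriv_gB_disj {d : ℕ} (φ : Euc d → ℝ) (hf : ∀ n : ℕ, ContDiff ℝ n φ)
    (h : ∀ x, 1 / 4 ≤ ‖x‖ → φ x = 0) (N : ℕ) (k : ℕ) (x : Euc d) (i j : Fin d → Fin N)
    (hi : iteratedFDeriv ℝ k (gB φ N i) x ≠ 0) (hj : iteratedFDeriv ℝ k (gB φ N j) x ≠ 0) :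
    i = j := by
  rw [iteratedFDeriv_gB φ hf] at hi hj
  have key : ∀ y, iteratedFDeriv ℝ k φ y ≠ 0 → ‖y‖ ≤ 1 / 4 := by
    intro y hy
    have := tsupp_phi φ h (support_iteratedFDeriv_subset (𝕜 := ℝ) k hy)
    simpa using this
  exact near_sep i j _ (key _ (right_ne_zero_of_smul hi)) (key _ (right_ne_zero_of_smul hj))

lemma gB_disj {d : ℕ} (φ : Euc d → ℝ)
    (h : ∀ x, 1 / 4 ≤ ‖x‖ → φ x = 0) (N : ℕ) (x : Euc d) (i j : Fin d → Fin N)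
    (hi : gB φ N i x ≠ 0) (hj : gB φ N j x ≠ 0) : i = j := by
  have key : ∀ y, φ y ≠ 0 → ‖y‖ ≤ 1 / 4 := by
    intro y hy
    by_contra h2
    exact hy (h y (by linarith))
  exact near_sep i j _ (key _ hi) (key _ hj)

lemma gB_ball {d : ℕ} (φ : Euc d → ℝ)
    (h : ∀ x, 1 / 4 ≤ ‖x‖ → φ x = 0) (N : ℕ) (hN : 0 < N) (x : Euc d) (j : Fin d → Fin N)
    (hx : x ∉ Metric.ball (0 : Euc d) (d + 1)) : gB φ N j x = 0 := by
  apply h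
  have hx' : (d : ℝ) + 1 ≤ ‖x‖ := by simpa using hx
  have h1 := norm_sub_norm_le ((N : ℝ) • x) (kap d N j)
  have h2 := kap_norm j
  have hN' : (1 : ℝ) ≤ N := by exact_mod_cast hN
  rw [norm_smul] at h1
  simp only [RCLike.norm_natCast] at h1
  have : (N : ℝ) * (d + 1) ≤ N * ‖x‖ := by gcongr
  nlinarith

lemma integral_gB {d : ℕ} (φ : Euc d → ℝ) (N : ℕ) (j : Fin d → Fin N) (F : ℝ → ℝ) :
    ∫ x, F (gB φ N j x) = ((N : ℝ) ^ d)⁻¹ * ∫ x, F (φ x) := by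
  have h := Measure.integral_comp_smul_of_nonneg (volume : Measure (Euc d))
    (fun y => F (φ (y - kap d N j))) (N : ℝ) (hR := Nat.cast_nonneg N)
  unfold gB
  rw [h, integral_sub_right_eq_self (fun y => F (φ y))]
  simp

lemma integral_phi_odd {d : ℕ} (φ : Euc d → ℝ) (ho : ∀ x, φ (-x) = - φ x) (F : ℝ → ℝ) :
    ∫ x, F (φ x) = ∫ x, F (- φ x) := by
  rw [← integral_neg_eq_self (fun x => F (φ x))]
  simp_rw [ho]

structure PhiOK {d : ℕ} (φ : Euc d → ℝ) : Prop where
  smooth : ∀ n : ℕ, ContDiff ℝ n φ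
  odd : ∀ x, φ (-x) = - φ x
  supp : ∀ x, 1 / 4 ≤ ‖x‖ → φ x = 0
  le_one : ∀ x, |φ x| ≤ 1
  pos : 0 < ∫ x, φ x ^ 2

def Sg {d : ℕ} (φ : Euc d → ℝ) (N : ℕ) (t : ℝ) (σ : (Fin d → Fin N) → Bool) (x : Euc d) : ℝ :=
  ∑ j, sgnB (σ j) * (t * gB φ N j x)

lemma gB_contDiff {d : ℕ} {φ : Euc d → ℝ} (hφ : PhiOK φ) (N : ℕ) (j : Fin d → Fin N) (n : ℕ) :
    ContDiff ℝ n (gB φ N j) :=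
  (hφ.smooth n).comp ((contDiff_id.const_smul (N : ℝ)).sub contDiff_const)

lemma Sg_contDiff {d : ℕ} {φ : Euc d → ℝ} (hφ : PhiOK φ) (N : ℕ) (t : ℝ)
    (σ : (Fin d → Fin N) → Bool) (n : ℕ) : ContDiff ℝ n (Sg φ N t σ) := by
  unfold Sg
  exact ContDiff.sum fun j _ => contDiff_const.mul (contDiff_const.mul (gB_contDiff hφ N j n))

lemma gB_cont {d : ℕ} {φ : Euc d → ℝ} (hφ : PhiOK φ) (N : ℕ) (j : Fin d → Fin N) :
    Continuous (gB φ N j) := (gB_contDiff hφ N j 0).continuous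

lemma Sg_cont {d : ℕ} {φ : Euc d → ℝ} (hφ : PhiOK φ) (N : ℕ) (t : ℝ)
    (σ : (Fin d → Fin N) → Bool) : Continuous (Sg φ N t σ) := (Sg_contDiff hφ N t σ 0).continuous

lemma iteratedFDeriv_Sg {d : ℕ} {φ : Euc d → ℝ} (hφ : PhiOK φ) (N : ℕ) (t : ℝ)
    (σ : (Fin d → Fin N) → Bool) (k : ℕ) (x : Euc d) :
    iteratedFDeriv ℝ k (Sg φ N t σ) x =
      ∑ j, sgnB (σ j) • (t • iteratedFDeriv ℝ k (gB φ N j) x) := by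
  have e : Sg φ N t σ = fun x => ∑ j, (sgnB (σ j) * t) • gB φ N j x := by
    funext x; simp [Sg, mul_assoc]
  rw [e, iteratedFDeriv_fun_sum_apply
    (fun j _ => ((gB_contDiff hφ N j k).const_smul (sgnB (σ j) * t)).contDiffAt)]
  refine Finset.sum_congr rfl fun j _ => ?_
  rw [smul_smul]
  exact iteratedFDeriv_const_smul_apply' (a := sgnB (σ j) * t) (gB_contDiff hφ N j k).contDiffAt

lemma Sg_norm {d : ℕ} {φ : Euc d → ℝ} (hφ : PhiOK φ) (N : ℕ) (t : ℝ) (ht : 0 ≤ t)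
    (σ : (Fin d → Fin N) → Bool) (k : ℕ) (x : Euc d) (C : ℝ)
    (hC : ∀ y, ‖iteratedFDeriv ℝ k φ y‖ ≤ C) (htk : t * (N : ℝ) ^ k ≤ 1) :
    ‖iteratedFDeriv ℝ k (Sg φ N t σ) x‖ ≤ 2 * C := by
  have hC0 : 0 ≤ C := (norm_nonneg _).trans (hC 0)
  have h := sum_disjoint_diff (fun j => sgnB (σ j)) (fun j => (abs_sgnB _).le)
    (fun j => t • iteratedFDeriv ℝ k (gB φ N j) x) (fun _ => 0)
    (fun i j hi hj => iteratedFDeriv_gB_disj φ hφ.smooth hφ.supp N k x i j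
      (right_ne_zero_of_smul hi) (right_ne_zero_of_smul hj))
    (fun i j hi hj => absurd rfl hi) C hC0 (fun j => by
      rw [sub_zero, iteratedFDeriv_gB φ hφ.smooth, smul_smul, norm_smul, Real.norm_eq_abs,
        abs_of_nonneg (by positivity)]
      calc _ ≤ 1 * C := mul_le_mul htk (hC _) (norm_nonneg _) zero_le_one
        _ = C := one_mul C)
  rw [iteratedFDeriv_Sg hφ]
  simpa using h

lemma Sg_diff {d : ℕ} {φ : Euc d → ℝ} (hφ : PhiOK φ) (N : ℕ) (t : ℝ) (ht : 0 ≤ t)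
    (σ : (Fin d → Fin N) → Bool) (k : ℕ) (x y : Euc d) (C s : ℝ) (hC0 : 0 ≤ C)
    (hC : ∀ y z, ‖iteratedFDeriv ℝ k φ y - iteratedFDeriv ℝ k φ z‖ ≤ C * ‖y - z‖ ^ s) (B : ℝ)
    (hB : 0 ≤ B) (htk : t * (N : ℝ) ^ k * (N : ℝ) ^ s ≤ B) :
    ‖iteratedFDeriv ℝ k (Sg φ N t σ) x - iteratedFDeriv ℝ k (Sg φ N t σ) y‖
      ≤ 2 * (B * (C * ‖x - y‖ ^ s)) := by
  rw [iteratedFDeriv_Sg hφ, iteratedFDeriv_Sg hφ]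
  refine sum_disjoint_diff (fun j => sgnB (σ j)) (fun j => (abs_sgnB _).le)
    (fun j => t • iteratedFDeriv ℝ k (gB φ N j) x) (fun j => t • iteratedFDeriv ℝ k (gB φ N j) y)
    (fun i j hi hj => iteratedFDeriv_gB_disj φ hφ.smooth hφ.supp N k x i j
      (right_ne_zero_of_smul hi) (right_ne_zero_of_smul hj))
    (fun i j hi hj => iteratedFDeriv_gB_disj φ hφ.smooth hφ.supp N k y i j
      (right_ne_zero_of_smul hi) (right_ne_zero_of_smul hj)) _ (by positivity) (fun j => ?_)
  rw [iteratedFDeriv_gB φ hφ.smooth, iteratedFDeriv_gB φ hφ.smooth, ← smul_sub, ← smul_sub,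
    smul_smul, norm_smul, Real.norm_eq_abs, abs_of_nonneg (by positivity)]
  have e : ‖((N : ℝ) • x - kap d N j) - ((N : ℝ) • y - kap d N j)‖ = N * ‖x - y‖ := by
    rw [sub_sub_sub_cancel_right, ← smul_sub, norm_smul]; simp
  have h := hC ((N : ℝ) • x - kap d N j) ((N : ℝ) • y - kap d N j)
  rw [e, mul_rpow (by positivity) (by positivity)] at h
  calc _ ≤ t * (N : ℝ) ^ k * (C * ((N : ℝ) ^ s * ‖x - y‖ ^ s)) := by gcongr
    _ = (t * (N : ℝ) ^ k * (N : ℝ) ^ s) * (C * ‖x - y‖ ^ s) := by ring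
    _ ≤ _ := by gcongr

lemma Sg_abs_le {d : ℕ} {φ : Euc d → ℝ} (hφ : PhiOK φ) (N : ℕ) (t : ℝ) (ht : 0 ≤ t) (ht1 : t ≤ 1)
    (σ : (Fin d → Fin N) → Bool) (x : Euc d) : |Sg φ N t σ x| ≤ 2 := by
  have := Sg_norm hφ N t ht σ 0 x 1 (fun y => by simpa using hφ.le_one y) (by simpa using ht1)
  simpa using this

lemma Sg_eq_of_ne {d : ℕ} {φ : Euc d → ℝ} (hφ : PhiOK φ) (N : ℕ) (t : ℝ)
    (σ : (Fin d → Fin N) → Bool) (x : Euc d) (j : Fin d → Fin N) (hj : gB φ N j x ≠ 0) :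
    Sg φ N t σ x = sgnB (σ j) * (t * gB φ N j x) := by
  unfold Sg
  rw [Finset.sum_eq_single j]
  · intro i _ hi
    have : gB φ N i x = 0 := by
      by_contra h
      exact hi (gB_disj φ hφ.supp N x i j h hj)
    simp [this]
  · simp

lemma exp_Sg {d : ℕ} {φ : Euc d → ℝ} (hφ : PhiOK φ) (N : ℕ) (t : ℝ)
    (σ : (Fin d → Fin N) → Bool) (x : Euc d) :
    exp (Sg φ N t σ x) = 1 + ∑ j, (exp (sgnB (σ j) * (t * gB φ N j x)) - 1) := by
  by_cases h : ∃ j, gB φ N j x ≠ 0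
  · obtain ⟨j, hj⟩ := h
    rw [Sg_eq_of_ne hφ N t σ x j hj, Finset.sum_eq_single j]
    · ring
    · intro i _ hi
      have : gB φ N i x = 0 := by
        by_contra h
        exact hi (gB_disj φ hφ.supp N x i j h hj)
      simp [this]
    · simp
  · push Not at h
    simp [Sg, h]

lemma gB_exp_Sg {d : ℕ} {φ : Euc d → ℝ} (hφ : PhiOK φ) (N : ℕ) (t : ℝ)
    (σ : (Fin d → Fin N) → Bool) (x : Euc d) (j : Fin d → Fin N) :
    gB φ N j x * exp (Sg φ N t σ x) = gB φ N j x * exp (sgnB (σ j) * (t * gB φ N j x)) := by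
  by_cases h : gB φ N j x = 0
  · simp [h]
  · rw [Sg_eq_of_ne hφ N t σ x j h]

def Bd (d : ℕ) : Set (Euc d) := Metric.ball 0 (d + 1)

def muB (d : ℕ) : Measure (Euc d) := volume.restrict (Bd d)

instance (d : ℕ) : IsFiniteMeasure (muB d) :=
  ⟨by rw [muB, Measure.restrict_apply_univ]; exact measure_ball_lt_top⟩

lemma int_muB {d : ℕ} {f : Euc d → ℝ} (hf : Continuous f) : Integrable f (muB d) :=
  (hf.continuousOn.integrableOn_compact (isCompact_closedBall (0 : Euc d) (d + 1))).mono_set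
    Metric.ball_subset_closedBall

def Vol (d : ℕ) : ℝ := (muB d).real univ

lemma Vol_pos (d : ℕ) : 0 < Vol d := by
  unfold Vol
  rw [measureReal_def]
  apply ENNReal.toReal_pos
  · rw [muB, Measure.restrict_apply_univ]
    exact (Metric.measure_ball_pos volume _ (by positivity)).ne'
  · exact measure_ne_top _ _

lemma muB_integral_gB {d : ℕ} {φ : Euc d → ℝ} (hφ : PhiOK φ) (N : ℕ) (hN : 0 < N)
    (j : Fin d → Fin N) (F : ℝ → ℝ) (hF : F 0 = 0) :
    ∫ x, F (gB φ N j x) ∂(muB d) = ((N : ℝ) ^ d)⁻¹ * ∫ x, F (φ x) := by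
  rw [← integral_gB, muB]
  apply setIntegral_eq_integral_of_forall_compl_eq_zero
  intro x hx
  rw [gB_ball φ hφ.supp N hN x j hx, hF]

def Zc {d : ℕ} (φ : Euc d → ℝ) (t : ℝ) : ℝ := Vol d + ∫ x, (exp (t * φ x) - 1)

lemma integral_exp_Sg {d : ℕ} {φ : Euc d → ℝ} (hφ : PhiOK φ) (N : ℕ) (hN : 0 < N) (t : ℝ)
    (σ : (Fin d → Fin N) → Bool) : ∫ x, exp (Sg φ N t σ x) ∂(muB d) = Zc φ t := by
  simp_rw [exp_Sg hφ]
  have hi : ∀ j, Integrable (fun x => exp (sgnB (σ j) * (t * gB φ N j x)) - 1) (muB d) := by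
    intro j
    have := gB_cont hφ N j
    exact int_muB (by fun_prop)
  rw [integral_add (integrable_const 1) (integrable_finsetSum _ fun j _ => hi j),
    integral_finsetSum _ fun j _ => hi j, integral_const]
  have e : ∀ j, ∫ x, (exp (sgnB (σ j) * (t * gB φ N j x)) - 1) ∂(muB d)
      = ((N : ℝ) ^ d)⁻¹ * ∫ x, (exp (t * φ x) - 1) := by
    intro j
    rw [muB_integral_gB hφ N hN j (fun y => exp (sgnB (σ j) * (t * y)) - 1) (by simp)]
    congr 1
    cases σ j
    · rw [integral_phi_odd φ hφ.odd (fun y => exp (sgnB false * (t * y)) - 1)]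
      simp [sgnB]
    · simp [sgnB]
  simp_rw [e]
  have : (N : ℝ) ≠ 0 := by exact_mod_cast hN.ne'
  simp [Zc, Vol]
  field_simp

lemma Zc_bounds {d : ℕ} {φ : Euc d → ℝ} (hφ : PhiOK φ) (t : ℝ) (ht : 0 ≤ t) (ht1 : t ≤ 1) :
    exp (-2) * Vol d ≤ Zc φ t ∧ Zc φ t ≤ exp 2 * Vol d := by
  rw [← integral_exp_Sg hφ 1 one_pos t (fun _ => true)]
  have hc := Sg_cont hφ 1 t (fun _ => true)
  have hI : Integrable (fun x => exp (Sg φ 1 t (fun _ => true) x)) (muB d) :=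
    int_muB (by fun_prop)
  have h : ∀ c : ℝ, c * Vol d = ∫ x, c ∂(muB d) := fun c => by
    rw [integral_const, smul_eq_mul, Vol, mul_comm]
  rw [h, h]
  constructor
  · refine integral_mono (integrable_const _) hI fun x => ?_
    have := abs_le.1 (Sg_abs_le hφ 1 t ht ht1 (fun _ => true) x)
    exact exp_le_exp.2 this.1
  · refine integral_mono hI (integrable_const _) fun x => ?_
    have := abs_le.1 (Sg_abs_le hφ 1 t ht ht1 (fun _ => true) x)
    exact exp_le_exp.2 this.2

lemma Zc_pos {d : ℕ} {φ : Euc d → ℝ} (hφ : PhiOK φ) (t : ℝ) (ht : 0 ≤ t) (ht1 : t ≤ 1) :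
    0 < Zc φ t :=
  lt_of_lt_of_le (mul_pos (exp_pos _) (Vol_pos d)) (Zc_bounds hφ t ht ht1).1

lemma Zc_log {d : ℕ} {φ : Euc d → ℝ} (hφ : PhiOK φ) (t : ℝ) (ht : 0 ≤ t) (ht1 : t ≤ 1) :
    |Real.log (Zc φ t)| ≤ |Real.log (Vol d)| + 2 := by
  have h := Zc_bounds hφ t ht ht1
  have hV := Vol_pos d
  have h1 := Real.log_le_log (mul_pos (exp_pos _) hV) h.1
  have h2 := Real.log_le_log (Zc_pos hφ t ht ht1) h.2
  rw [Real.log_mul (exp_pos _).ne' hV.ne', Real.log_exp] at h1 h2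
  have := neg_abs_le (Real.log (Vol d))
  have := le_abs_self (Real.log (Vol d))
  rw [abs_le]
  constructor <;> linarith

/-- density w.r.t. `muB` -/
def eD {d : ℕ} (φ : Euc d → ℝ) (N : ℕ) (t : ℝ) (σ : (Fin d → Fin N) → Bool) (x : Euc d) : ℝ :=
  (Zc φ t)⁻¹ * exp (Sg φ N t σ x)

lemma eD_cont {d : ℕ} {φ : Euc d → ℝ} (hφ : PhiOK φ) (N : ℕ) (t : ℝ)
    (σ : (Fin d → Fin N) → Bool) : Continuous (eD φ N t σ) := by
  have := Sg_cont hφ N t σ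
  unfold eD
  fun_prop

lemma eD_pos {d : ℕ} {φ : Euc d → ℝ} (hφ : PhiOK φ) (N : ℕ) (t : ℝ) (ht : 0 ≤ t) (ht1 : t ≤ 1)
    (σ : (Fin d → Fin N) → Bool) (x : Euc d) : 0 < eD φ N t σ x :=
  mul_pos (inv_pos.2 (Zc_pos hφ t ht ht1)) (exp_pos _)

lemma eD_int {d : ℕ} {φ : Euc d → ℝ} (hφ : PhiOK φ) (N : ℕ) (hN : 0 < N) (t : ℝ) (ht : 0 ≤ t)
    (ht1 : t ≤ 1) (σ : (Fin d → Fin N) → Bool) : ∫ x, eD φ N t σ x ∂(muB d) = 1 := by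
  unfold eD
  rw [integral_const_mul, integral_exp_Sg hφ N hN]
  exact inv_mul_cancel₀ (Zc_pos hφ t ht ht1).ne'

/-- density on the whole space -/
def pD {d : ℕ} (φ : Euc d → ℝ) (N : ℕ) (t : ℝ) (σ : (Fin d → Fin N) → Bool) : Euc d → ℝ :=
  (Bd d).indicator (eD φ N t σ)

lemma measurableSet_Bd (d : ℕ) : MeasurableSet (Bd d) := Metric.isOpen_ball.measurableSet

lemma pD_withDensity {d : ℕ} (φ : Euc d → ℝ) (N : ℕ) (t : ℝ) (σ : (Fin d → Fin N) → Bool) :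
    (volume.withDensity fun x => ENNReal.ofReal (pD φ N t σ x)) =
      (muB d).withDensity fun x => ENNReal.ofReal (eD φ N t σ x) := by
  unfold muB
  rw [← withDensity_indicator (measurableSet_Bd d)]
  congr 1
  funext x
  by_cases h : x ∈ Bd d <;> simp [pD, h]

lemma integral_pD {d : ℕ} {φ : Euc d → ℝ} (hφ : PhiOK φ) (N : ℕ) (t : ℝ) (ht : 0 ≤ t)
    (ht1 : t ≤ 1) (σ : (Fin d → Fin N) → Bool) (f : Euc d → ℝ) :
    ∫ x, f x ∂((muB d).withDensity fun x => ENNReal.ofReal (eD φ N t σ x)) =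
      ∫ x, eD φ N t σ x * f x ∂(muB d) := by
  rw [integral_withDensity_eq_integral_toReal_smul
    (eD_cont hφ N t σ).measurable.ennreal_ofReal
    (Filter.Eventually.of_forall fun x => ENNReal.ofReal_lt_top)]
  refine integral_congr_ae (Filter.Eventually.of_forall fun x => ?_)
  simp only [smul_eq_mul]
  rw [ENNReal.toReal_ofReal (eD_pos hφ N t ht ht1 σ x).le]

def Aint {d : ℕ} (φ : Euc d → ℝ) (t : ℝ) : ℝ := ∫ x, φ x * exp (t * φ x)

lemma integral_gB_pD {d : ℕ} {φ : Euc d → ℝ} (hφ : PhiOK φ) (N : ℕ) (hN : 0 < N) (t : ℝ)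
    (ht : 0 ≤ t) (ht1 : t ≤ 1) (σ : (Fin d → Fin N) → Bool) (j : Fin d → Fin N) :
    ∫ x, gB φ N j x ∂((muB d).withDensity fun x => ENNReal.ofReal (eD φ N t σ x)) =
      sgnB (σ j) * ((Zc φ t)⁻¹ * (((N : ℝ) ^ d)⁻¹ * Aint φ t)) := by
  rw [integral_pD hφ N t ht ht1]
  have e : ∀ x, eD φ N t σ x * gB φ N j x =
      (Zc φ t)⁻¹ * (gB φ N j x * exp (sgnB (σ j) * (t * gB φ N j x))) := by
    intro x
    rw [← gB_exp_Sg hφ N t σ x j, eD]; ring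
  simp_rw [e]
  rw [integral_const_mul, muB_integral_gB hφ N hN j
    (fun y => y * exp (sgnB (σ j) * (t * y))) (by simp)]
  have : ∫ x, φ x * exp (sgnB (σ j) * (t * φ x)) = sgnB (σ j) * Aint φ t := by
    unfold Aint
    cases σ j
    · rw [integral_phi_odd φ hφ.odd (fun y => y * exp (sgnB false * (t * y))),
        ← integral_const_mul]
      simp [sgnB]
    · simp [sgnB]
  rw [this]; ring

lemma phi_integrable {d : ℕ} {φ : Euc d → ℝ} (hφ : PhiOK φ) (F : ℝ → ℝ) (hF : Continuous F)
    (h0 : F 0 = 0) : Integrable (fun x => F (φ x)) := by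
  apply (hF.comp (hφ.smooth 0).continuous).integrable_of_hasCompactSupport
  refine HasCompactSupport.intro (isCompact_closedBall (0 : Euc d) (1/4)) fun x hx => ?_
  have : 1 / 4 ≤ ‖x‖ := by
    simp at hx; norm_num; linarith
  simp [hφ.supp x this, h0]

lemma Aint_ge {d : ℕ} {φ : Euc d → ℝ} (hφ : PhiOK φ) (t : ℝ) (ht : 0 ≤ t) :
    t * ∫ x, φ x ^ 2 ≤ Aint φ t := by
  have e : Aint φ t = ∫ x, (-φ x) * exp (t * (- φ x)) :=
    integral_phi_odd φ hφ.odd (fun y => y * exp (t * y))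
  have i1 : Integrable fun x => φ x * exp (t * φ x) :=
    phi_integrable hφ (fun y => y * exp (t * y)) (by fun_prop) (by simp)
  have i2 : Integrable fun x => (-φ x) * exp (t * (- φ x)) :=
    phi_integrable hφ (fun y => (-y) * exp (t * (-y))) (by fun_prop) (by simp)
  have i3 : Integrable fun x => (2 * t) * φ x ^ 2 :=
    phi_integrable hφ (fun y => (2 * t) * y ^ 2) (by fun_prop) (by simp)
  have h : ∫ x, (2 * t) * φ x ^ 2 ≤ ∫ x, (φ x * exp (t * φ x) + (-φ x) * exp (t * (- φ x))) := by
    refine integral_mono i3 (i1.add i2) fun x => ?_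
    simp only
    have hs := Real.sinh_eq (t * φ x)
    have e2 : φ x * exp (t * φ x) + (-φ x) * exp (t * (- φ x)) = 2 * (φ x * sinh (t * φ x)) := by
      rw [hs]; ring_nf
    rw [e2]
    rcases le_total 0 (φ x) with h | h
    · have := Real.self_le_sinh_iff.2 (mul_nonneg ht h)
      nlinarith
    · have := Real.sinh_le_self_iff.2 (mul_nonpos_of_nonneg_of_nonpos ht h)
      nlinarith
  rw [integral_add i1 i2, ← e, integral_const_mul] at h
  unfold Aint at *
  linarith

lemma hell_pt {d : ℕ} {φ : Euc d → ℝ} (hφ : PhiOK φ) (N : ℕ) (t : ℝ) (ht : 0 ≤ t)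
    (ht1 : t ≤ 1) (σ : (Fin d → Fin N) → Bool) (j : Fin d → Fin N) (x : Euc d) :
    (eD φ N t σ x + eD φ N t (flipB j σ) x) / 2 - √(eD φ N t σ x * eD φ N t (flipB j σ) x) ≤
      ((Zc φ t)⁻¹ * t ^ 2) * (gB φ N j x) ^ 2 := by
  have hZ := inv_pos.2 (Zc_pos hφ t ht ht1)
  by_cases h : gB φ N j x = 0
  · have e : Sg φ N t (flipB j σ) x = Sg φ N t σ x := by
      unfold Sg
      refine Finset.sum_congr rfl fun i _ => ?_
      by_cases hij : i = j
      · subst hij; simp [h]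
      · simp [flipB, hij]
    have e2 : eD φ N t (flipB j σ) x = eD φ N t σ x := by simp [eD, e]
    rw [e2, Real.sqrt_mul_self (eD_pos hφ N t ht ht1 σ x).le, h]
    simp
  · have e1 := Sg_eq_of_ne hφ N t σ x j h
    have e2 := Sg_eq_of_ne hφ N t (flipB j σ) x j h
    have e3 : sgnB (flipB j σ j) = - sgnB (σ j) := by simp [flipB, sgnB_not]
    rw [e3] at e2
    set g := gB φ N j x
    have hg : |g| ≤ 1 := hφ.le_one _
    have hs : sgnB (σ j) ^ 2 = 1 := by rw [← sq_abs, abs_sgnB]; norm_num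
    set y := sgnB (σ j) * (t * g) with hy
    have e4 : eD φ N t σ x = (Zc φ t)⁻¹ * exp y := by rw [eD, e1]
    have e5 : eD φ N t (flipB j σ) x = (Zc φ t)⁻¹ * exp (-y) := by
      rw [eD, e2, hy]; ring_nf
    have e6 : (Zc φ t)⁻¹ * exp y * ((Zc φ t)⁻¹ * exp (-y)) = (Zc φ t)⁻¹ * (Zc φ t)⁻¹ := by
      rw [exp_neg]; field_simp
    rw [e4, e5, e6, Real.sqrt_mul_self hZ.le]
    have hy2 : y ^ 2 = t ^ 2 * g ^ 2 := by rw [hy, mul_pow, hs]; ring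
    have hg2 : g ^ 2 ≤ 1 := by rw [← sq_abs]; exact pow_le_one₀ (abs_nonneg _) hg
    have ht2 : t ^ 2 ≤ 1 := pow_le_one₀ ht ht1
    have hy1 : y ^ 2 ≤ 1 := by
      rw [hy2]; nlinarith [sq_nonneg g, sq_nonneg t]
    have hc : cosh y ≤ 1 + y ^ 2 := by
      refine (Real.cosh_le_exp_half_sq y).trans ?_
      have hb := Real.abs_exp_sub_one_le (x := y ^ 2 / 2) (by rw [abs_of_nonneg (by positivity)]; linarith)
      rw [abs_of_nonneg (a := y ^ 2 / 2) (by positivity)] at hb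
      have := le_abs_self (exp (y ^ 2 / 2) - 1)
      linarith
    rw [Real.cosh_eq] at hc
    rw [mul_assoc, ← hy2]
    have := mul_le_mul_of_nonneg_left hc hZ.le
    linarith

lemma hell_int {d : ℕ} {φ : Euc d → ℝ} (hφ : PhiOK φ) (N : ℕ) (hN : 0 < N) (t : ℝ) (ht : 0 ≤ t)
    (ht1 : t ≤ 1) (σ : (Fin d → Fin N) → Bool) (j : Fin d → Fin N) :
    ∫ x, ((eD φ N t σ x + eD φ N t (flipB j σ) x) / 2 -
      √(eD φ N t σ x * eD φ N t (flipB j σ) x)) ∂(muB d) ≤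
      ((Zc φ t)⁻¹ * t ^ 2) * (((N : ℝ) ^ d)⁻¹ * ∫ x, φ x ^ 2) := by
  rw [← muB_integral_gB hφ N hN j (fun y => y ^ 2) (by simp), ← integral_const_mul]
  have h1 := eD_cont hφ N t σ
  have h2 := eD_cont hφ N t (flipB j σ)
  have h3 := gB_cont hφ N j
  exact integral_mono (int_muB (by fun_prop)) (int_muB (by fun_prop))
    (hell_pt hφ N t ht ht1 σ j)

lemma W1_ge {d : ℕ} (P Q : Measure (Euc d)) [IsProbabilityMeasure P] [IsProbabilityMeasure Q]
    (hP : Integrable (fun x : Euc d => ‖x‖) P) (hQ : Integrable (fun x : Euc d => ‖x‖) Q)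
    (f : Euc d → ℝ) (hf : LipschitzWith 1 f) : (∫ x, f x ∂P) - ∫ x, f x ∂Q ≤ W1 P Q := by
  have key : ∀ (μ : Measure (Euc d)) [IsProbabilityMeasure μ],
      Integrable (fun x : Euc d => ‖x‖) μ → ∀ g : Euc d → ℝ, LipschitzWith 1 g →
      |(∫ x, g x ∂μ) - g 0| ≤ ∫ x, ‖x‖ ∂μ := by
    intro μ _ hμ g hg
    have hb : ∀ x, ‖g x - g 0‖ ≤ ‖x‖ := fun x => by
      have := hg.dist_le_mul x 0
      simpa [dist_eq_norm] using this
    have hi : Integrable (fun x => g x - g 0) μ :=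
      Integrable.mono' hμ (hg.continuous.sub continuous_const).aestronglyMeasurable
        (Filter.Eventually.of_forall hb)
    have e : (∫ x, g x ∂μ) - g 0 = ∫ x, (g x - g 0) ∂μ := by
      have h2 : ∫ x, g x ∂μ = ∫ x, ((g x - g 0) + g 0) ∂μ := by simp
      rw [h2, integral_add hi (integrable_const _)]
      simp
    rw [e, ← Real.norm_eq_abs]
    exact norm_integral_le_of_norm_le hμ (Filter.Eventually.of_forall hb)
  unfold W1
  refine le_ciSup (f := fun f : {f : Euc d → ℝ // LipschitzWith 1 f} =>
    ((∫ x, f.1 x ∂P) - ∫ x, f.1 x ∂Q)) ⟨(∫ x, ‖x‖ ∂P) + ∫ x, ‖x‖ ∂Q, ?_⟩ ⟨f, hf⟩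
  rintro _ ⟨g, rfl⟩
  have h1 := abs_le.1 (key P hP g.1 g.2)
  have h2 := abs_le.1 (key Q hQ g.1 g.2)
  simp only
  linarith [h1.2, h2.1]

lemma Sg_lip {d : ℕ} {φ : Euc d → ℝ} (hφ : PhiOK φ) (L : ℝ) (hL : 0 < L)
    (hLip : ∀ x y, ‖iteratedFDeriv ℝ 0 φ x - iteratedFDeriv ℝ 0 φ y‖ ≤ L * ‖x - y‖ ^ (1 : ℝ))
    (N : ℕ) (hN : 0 < N) (τ : (Fin d → Fin N) → Bool) :
    LipschitzWith 1 (Sg φ N (1 / (2 * L * N)) τ) := by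
  have hN' : (0 : ℝ) < N := by exact_mod_cast hN
  apply LipschitzWith.of_dist_le_mul
  intro x y
  have h := Sg_diff hφ N (1 / (2 * L * N)) (by positivity) τ 0 x y L 1 hL.le hLip (1 / (2 * L))
    (by positivity) (by simp; field_simp; rfl)
  simp only [iteratedFDeriv_zero_eq_comp, Function.comp_apply] at h
  rw [← map_sub, LinearIsometryEquiv.norm_map, rpow_one] at h
  rw [dist_eq_norm, dist_eq_norm]
  refine h.trans (le_of_eq ?_)
  simp
  field_simp

lemma W1_lower {d : ℕ} {φ : Euc d → ℝ} (hφ : PhiOK φ) (L : ℝ) (hL : 0 < L)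
    (hLip : ∀ x y, ‖iteratedFDeriv ℝ 0 φ x - iteratedFDeriv ℝ 0 φ y‖ ≤ L * ‖x - y‖ ^ (1 : ℝ))
    (N : ℕ) (hN : 0 < N) (t : ℝ) (ht : 0 ≤ t) (ht1 : t ≤ 1) (σ : (Fin d → Fin N) → Bool)
    (Q : Measure (Euc d)) [IsProbabilityMeasure Q] (hQ : Integrable (fun x : Euc d => ‖x‖) Q) :
    ∑ j, |sgnB (σ j) * (1 / (2 * L * N) * ((Zc φ t)⁻¹ * (((N : ℝ) ^ d)⁻¹ * Aint φ t))) -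
        1 / (2 * L * N) * ∫ x, gB φ N j x ∂Q| ≤
      W1 ((muB d).withDensity fun x => ENNReal.ofReal (eD φ N t σ x)) Q := by
  set P := (muB d).withDensity fun x => ENNReal.ofReal (eD φ N t σ x) with hPdef
  set T : ℝ := 1 / (2 * L * N)
  have hc := eD_cont hφ N t σ
  have hP1 : IsProbabilityMeasure P := by
    constructor
    rw [hPdef, withDensity_apply _ MeasurableSet.univ, setLIntegral_univ,
      ← ofReal_integral_eq_lintegral_ofReal (int_muB hc)
        (Filter.Eventually.of_forall fun x => (eD_pos hφ N t ht ht1 σ x).le),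
      eD_int hφ N hN t ht ht1, ENNReal.ofReal_one]
  have hPm : Integrable (fun x : Euc d => ‖x‖) P := by
    rw [hPdef, integrable_withDensity_iff_integrable_smul'
      (hc.measurable.ennreal_ofReal)
      (Filter.Eventually.of_forall fun x => ENNReal.ofReal_lt_top)]
    have : (fun x : Euc d => (ENNReal.ofReal (eD φ N t σ x)).toReal • ‖x‖) =
        fun x => eD φ N t σ x * ‖x‖ := by
      funext x
      rw [ENNReal.toReal_ofReal (eD_pos hφ N t ht ht1 σ x).le, smul_eq_mul]
    rw [this]
    exact int_muB (by fun_prop)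
  have hgi : ∀ (μ : Measure (Euc d)) [IsProbabilityMeasure μ] (j : Fin d → Fin N),
      Integrable (gB φ N j) μ := by
    intro μ _ j
    refine Integrable.mono' (integrable_const (1 : ℝ)) (gB_cont hφ N j).aestronglyMeasurable
      (Filter.Eventually.of_forall fun x => hφ.le_one _)
  have hSint : ∀ (μ : Measure (Euc d)) [IsProbabilityMeasure μ] (τ : (Fin d → Fin N) → Bool),
      ∫ x, Sg φ N T τ x ∂μ = ∑ j, sgnB (τ j) * (T * ∫ x, gB φ N j x ∂μ) := by
    intro μ _ τ
    unfold Sg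
    rw [integral_finsetSum _ fun j _ => ((hgi μ j).const_mul T).const_mul _]
    refine Finset.sum_congr rfl fun j _ => ?_
    rw [integral_const_mul, integral_const_mul]
  set D : (Fin d → Fin N) → ℝ := fun j =>
    sgnB (σ j) * (T * ((Zc φ t)⁻¹ * (((N : ℝ) ^ d)⁻¹ * Aint φ t))) - T * ∫ x, gB φ N j x ∂Q with hD
  let τ : (Fin d → Fin N) → Bool := fun j => decide (0 ≤ D j)
  have h := W1_ge P Q hPm hQ (Sg φ N T τ) (Sg_lip hφ L hL hLip N hN τ)
  refine le_trans (le_of_eq ?_) h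
  rw [hSint P, hSint Q, ← Finset.sum_sub_distrib]
  refine Finset.sum_congr rfl fun j _ => ?_
  rw [hPdef, integral_gB_pD hφ N hN t ht ht1]
  have e : sgnB (τ j) * D j = |D j| := by
    by_cases hd0 : 0 ≤ D j
    · simp [τ, hd0, sgnB, abs_of_nonneg hd0]
    · simp [τ, hd0, sgnB, abs_of_neg (not_le.1 hd0)]
  change |D j| = _
  rw [← e]
  simp only [hD]
  ring

lemma lower_N {d : ℕ} {φ : Euc d → ℝ} (hφ : PhiOK φ) (L : ℝ) (hL : 0 < L)
    (hLip : ∀ x y, ‖iteratedFDeriv ℝ 0 φ x - iteratedFDeriv ℝ 0 φ y‖ ≤ L * ‖x - y‖ ^ (1 : ℝ))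
    (N : ℕ) (hN : 0 < N) (t : ℝ) (ht : 0 ≤ t) (ht1 : t ≤ 1) (n : ℕ) (hn : 0 < n)
    (hδ : n * (((Zc φ t)⁻¹ * t ^ 2) * (((N : ℝ) ^ d)⁻¹ * ∫ x, φ x ^ 2)) ≤ 1 / 2)
    (phat : (Fin n → Euc d) → Measure (Euc d))
    (h1 : ∀ ω, IsProbabilityMeasure (phat ω))
    (h2 : ∀ ω, Integrable (fun x : Euc d => ‖x‖) (phat ω))
    (h3 : ∀ σ, Measurable (fun ω : Fin n → Euc d =>
            W1 (volume.withDensity fun x => ENNReal.ofReal (pD φ N t σ x)) (phat ω))) :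
    ∃ σ, ENNReal.ofReal (1 / (2 * L * N) * ((Zc φ t)⁻¹ * Aint φ t) * (1 / 8)) ≤
      ∫⁻ ω, ENNReal.ofReal
          (W1 (volume.withDensity fun x => ENNReal.ofReal (pD φ N t σ x)) (phat ω))
        ∂(Measure.pi fun _ : Fin n =>
            volume.withDensity fun x => ENNReal.ofReal (pD φ N t σ x)) := by
  have hN' : (0 : ℝ) < N := by exact_mod_cast hN
  have hZ := Zc_pos hφ t ht ht1
  have hA : 0 ≤ Aint φ t := le_trans (mul_nonneg ht hφ.pos.le) (Aint_ge hφ t ht)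
  simp_rw [pD_withDensity] at h3 ⊢
  have hi : ∀ σ, Integrable (eD φ N t σ) (muB d) := fun σ => int_muB (eD_cont hφ N t σ)
  have hm : ∀ σ, Measurable (eD φ N t σ) := fun σ => (eD_cont hφ N t σ).measurable
  have h0 : ∀ σ x, 0 ≤ eD φ N t σ x := fun σ x => (eD_pos hφ N t ht ht1 σ x).le
  set δ := ((Zc φ t)⁻¹ * t ^ 2) * (((N : ℝ) ^ d)⁻¹ * ∫ x, φ x ^ 2) with hδdef
  have hδ0 : 0 ≤ δ := by
    have := hφ.pos.le
    positivity
  have hδ1 : δ ≤ 1 := by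
    have : (1 : ℝ) ≤ n := by exact_mod_cast hn
    nlinarith
  obtain ⟨σ, hσ⟩ := assouad (Measure.pi fun _ : Fin n => muB d)
    (fun σ ω => ∏ i, eD φ N t σ (ω i)) (fun σ ω => Finset.prod_nonneg fun i _ => h0 σ _)
    (fun σ => Finset.measurable_prod _ fun i _ => (hm σ).comp (measurable_pi_apply i))
    (fun σ => Integrable.fintype_prod (fun _ => hi σ))
    (fun σ ω => W1 ((muB d).withDensity fun x => ENNReal.ofReal (eD φ N t σ x)) (phat ω)) h3
    (1 / (2 * L * N) * ((Zc φ t)⁻¹ * (((N : ℝ) ^ d)⁻¹ * Aint φ t))) (by positivity)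
    (fun j ω => 1 / (2 * L * N) * ∫ x, gB φ N j x ∂(phat ω))
    (fun σ ω => by
      have := h1 ω
      exact W1_lower hφ L hL hLip N hN t ht ht1 σ (phat ω) (h2 ω))
    (1 / 8)
    (fun σ j => affinity (muB d) n (eD φ N t σ) (eD φ N t (flipB j σ)) (h0 _) (h0 _) (hm _) (hm _)
      (hi _) (hi _) (eD_int hφ N hN t ht ht1 _) (eD_int hφ N hN t ht ht1 _) δ
      (hell_int hφ N hN t ht ht1 σ j) hδ1 hδ)
  refine ⟨σ, ?_⟩
  rw [pi_withDensity_ofReal (muB d) n _ (h0 σ) (hi σ)]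
  refine le_trans (le_of_eq ?_) hσ
  congr 1
  simp
  field_simp

def qf {d : ℕ} (x : Euc d) : ℝ := ‖x‖ ^ 2 / 2

lemma qf_contDiff {d : ℕ} (n : ℕ) : ContDiff ℝ n (qf (d := d)) :=
  (contDiff_norm_sq ℝ).div_const 2

lemma qf_hess {d : ℕ} (x v : Euc d) : iteratedFDeriv ℝ 2 (qf (d := d)) x ![v, v] = ‖v‖ ^ 2 := by
  rw [iteratedFDeriv_two_apply]
  have e : fderiv ℝ (qf (d := d)) = fun x => innerSL ℝ x := by
    funext y
    have h := (hasStrictFDerivAt_norm_sq y).hasFDerivAt.const_mul (1 / 2 : ℝ)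
    have h2 : qf (d := d) = fun y => (1 / 2 : ℝ) * ‖y‖ ^ 2 := by funext z; simp [qf]; ring
    rw [h2, h.fderiv]
    ext w
    simp
  rw [e, ContinuousLinearMap.fderiv]
  simp
  exact real_inner_self_eq_norm_sq v

lemma const_deriv_norm {d : ℕ} (c : ℝ) (k : ℕ) (x : Euc d) :
    ‖iteratedFDeriv ℝ k (fun _ : Euc d => c) x‖ ≤ |c| := by
  cases k with
  | zero => simp
  | succ k => rw [iteratedFDeriv_succ_const]; simp

lemma const_deriv_sub {d : ℕ} (c : ℝ) (k : ℕ) (x y : Euc d) :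
    iteratedFDeriv ℝ k (fun _ : Euc d => c) x = iteratedFDeriv ℝ k (fun _ : Euc d => c) y := by
  cases k with
  | zero => ext; simp
  | succ k => rw [iteratedFDeriv_succ_const]; simp

lemma exists_K0 {d : ℕ} {φ : Euc d → ℝ} (hφ : PhiOK φ) (β : ℝ) (hβ : 0 < β) :
    ∃ K₀ : ℝ, 1 ≤ K₀ ∧ ∀ K, K₀ ≤ K → ∀ N : ℕ, 0 < N → ∀ σ : (Fin d → Fin N) → Bool,
      Assumption1 d β K (pD φ N ((N : ℝ) ^ (-β)) σ) := by
  set m := ⌊β⌋₊ with hm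
  have hmβ : (m : ℝ) ≤ β := Nat.floor_le hβ.le
  have hs0 : 0 ≤ β - m := by linarith
  have hs1 : β - m ≤ 1 := by have := (Nat.lt_floor_add_one β).le; rw [← hm] at this; linarith
  have hq := fun k => holder_of_bdd (qf (d := d)) qf_contDiff (Bd d) (convex_ball _ _)
    (bdd_ball _ qf_contDiff _) (β - m) hs0 hs1 k
  have hf := fun k => holder_of_bdd φ hφ.smooth univ convex_univ
    (bdd_univ _ hφ.smooth hφ.supp) (β - m) hs0 hs1 k
  choose Cq hCq0 hCq hCqd using hq
  choose Cf hCf0 hCf hCfd using hf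
  set M : ℕ → ℝ := fun k => Cq k + (|Real.log (Vol d)| + 2) + 2 * Cf k with hM
  have hM0 : ∀ k, 0 ≤ M k := fun k => by
    have := hCq0 k
    have := hCf0 k
    positivity
  set H : ℝ := Cq m + 2 * Cf m with hH
  have hH0 : 0 ≤ H := by
    have := hCq0 m
    have := hCf0 m
    positivity
  refine ⟨1 + ∑ k ∈ Finset.range (m + 2), M k + H, ?_, ?_⟩
  · have := Finset.sum_nonneg (s := Finset.range (m + 2)) fun k _ => hM0 k
    linarith
  intro K hK N hN σ
  set t := (N : ℝ) ^ (-β) with htdef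
  have hN' : (0 : ℝ) < N := by exact_mod_cast hN
  have hN1 : (1 : ℝ) ≤ N := by exact_mod_cast hN
  have ht : 0 ≤ t := by positivity
  have ht1 : t ≤ 1 := rpow_le_one_of_one_le_of_nonpos hN1 (by linarith)
  have hK1 : 1 ≤ K := by
    have := Finset.sum_nonneg (s := Finset.range (m + 2)) fun k _ => hM0 k
    linarith
  have hsup : Function.support (pD φ N t σ) = Bd d := by
    ext x
    by_cases h : x ∈ Bd d
    · simp [pD, h, (eD_pos hφ N t ht ht1 σ x).ne']
    · simp [pD, h]
  have hopen : IsOpen (Bd d) := Metric.isOpen_ball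
  have hc := eD_cont hφ N t σ
  refine ⟨⟨?_, ?_, ?_⟩, ?_⟩
  · intro x
    exact indicator_nonneg (fun x _ => (eD_pos hφ N t ht ht1 σ x).le) x
  · exact hc.measurable.indicator (measurableSet_Bd d)
  · unfold pD
    rw [integral_indicator (measurableSet_Bd d)]
    exact eD_int hφ N hN t ht ht1 σ
  have hacd : ∀ k : ℕ, ContDiff ℝ k (fun x => qf x + -Real.log (Zc φ t) + Sg φ N t σ x) :=
    fun k => ((qf_contDiff k).add contDiff_const).add (Sg_contDiff hφ N t σ k)
  have hder : ∀ (k : ℕ) (x : Euc d),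
      iteratedFDeriv ℝ k (fun x => qf x + -Real.log (Zc φ t) + Sg φ N t σ x) x =
      iteratedFDeriv ℝ k qf x + iteratedFDeriv ℝ k (fun _ : Euc d => -Real.log (Zc φ t)) x +
        iteratedFDeriv ℝ k (Sg φ N t σ) x := by
    intro k x
    rw [fun_iteratedFDeriv_add_apply (((qf_contDiff k).add contDiff_const).contDiffAt)
      (Sg_contDiff hφ N t σ k).contDiffAt,
      fun_iteratedFDeriv_add_apply (qf_contDiff k).contDiffAt contDiff_const.contDiffAt]
  have htN : ∀ k : ℕ, t * (N : ℝ) ^ k = (N : ℝ) ^ ((k : ℝ) - β) := by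
    intro k
    rw [htdef, ← rpow_natCast, ← rpow_add hN']; congr 1; ring
  refine ⟨qf, fun x => qf x + -Real.log (Zc φ t) + Sg φ N t σ x, ?_, ?_, ?_, ?_, ?_, ?_⟩
  · intro x hx
    rw [hsup] at hx
    simp only [pD, hx, indicator_of_mem]
    rw [show -qf x + (qf x + -Real.log (Zc φ t) + Sg φ N t σ x) =
      -Real.log (Zc φ t) + Sg φ N t σ x by ring, exp_add, exp_neg,
      exp_log (Zc_pos hφ t ht ht1), eD]
  · rw [hsup]
    refine ⟨(hacd _).contDiffOn, M, H, ?_, ?_, ?_⟩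
    · intro k hk x hx
      rw [iteratedFDerivWithin_of_isOpen k hopen hx, hder]
      have a1 := hCq k x hx
      have a2 := const_deriv_norm (-Real.log (Zc φ t)) k x
      rw [abs_neg] at a2
      have a3 := Zc_log hφ t ht ht1
      have a4 := Sg_norm hφ N t ht σ k x (Cf k) (fun y => hCf k y (mem_univ y)) (by
        rw [htN]
        apply rpow_le_one_of_one_le_of_nonpos hN1
        have : (k : ℝ) ≤ m := by exact_mod_cast hk
        linarith)
      have a5 := norm_add₃_le (a := iteratedFDeriv ℝ k qf x)
        (b := iteratedFDeriv ℝ k (fun _ : Euc d => -Real.log (Zc φ t)) x)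
        (c := iteratedFDeriv ℝ k (Sg φ N t σ) x)
      simp only [hM]
      linarith
    · intro x hx y hy
      rw [iteratedFDerivWithin_of_isOpen _ hopen hx, iteratedFDerivWithin_of_isOpen _ hopen hy,
        hder, hder, const_deriv_sub _ _ x y]
      have a1 := hCqd m x hx y hy
      have a4 := Sg_diff hφ N t ht σ m x y (Cf m) (β - m) (hCf0 m)
        (fun y z => hCfd m y (mem_univ y) z (mem_univ z)) 1 zero_le_one (by
        rw [htN, ← rpow_add hN']
        simp)
      rw [add_sub_add_comm, add_sub_add_comm, sub_self, add_zero]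
      refine (norm_add_le _ _).trans ?_
      rw [hH]
      linarith
    · have := Finset.sum_range_succ M (m + 1)
      have h2 := hM0 (m + 1)
      linarith
  · exact (qf_contDiff _).contDiffOn
  · intro x hx v
    rw [hsup] at hx ⊢
    rw [iteratedFDerivWithin_of_isOpen 2 hopen hx, qf_hess]
    have : K⁻¹ ≤ 1 := inv_le_one_of_one_le₀ hK1
    nlinarith [sq_nonneg ‖v‖]
  · refine ⟨0, ?_, fun y _ => ?_, ?_⟩
    · rw [hsup]; exact Metric.mem_ball_self (by positivity)
    · simp [qf]; positivity
    · simp; linarith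
  · intro x hx y hy _ k hk
    rw [hsup] at hy ⊢
    rw [iteratedFDerivWithin_of_isOpen k hopen hy]
    have a1 := hCq k y hy
    have a2 : M k ≤ ∑ k ∈ Finset.range (m + 2), M k :=
      Finset.single_le_sum (fun k _ => hM0 k) (Finset.mem_range.2 (by omega))
    have a3 : Cq k ≤ M k := by
      simp only [hM]
      have := hCf0 k
      have := abs_nonneg (Real.log (Vol d))
      linarith
    have a4 : 0 ≤ |qf x| ^ K := by positivity
    nlinarith

/-- **Minimax lower bound in Wasserstein-1 distance (Theorem 5).**
There are `K₀ ≥ 1` and `c > 0`, depending only on `d` and `β`, such that for every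
`K ≥ K₀`, every `n ≥ 1` and every (measurable) estimator `p̂_n` mapping samples in
`(ℝ^d)ⁿ` to probability measures with finite first moment, the worst-case expected
`W₁` risk over `A^β_K` is at least `c · n^{-(β+1)/(2β+d)}`; here this is expressed
by exhibiting `p⋆ ∈ A^β_K` whose risk is at least `c · n^{-(β+1)/(2β+d)}`. -/
theorem minimax_lower_bound_W1
    (d : ℕ) (hd : 3 ≤ d) (β : ℝ) (hβ : 0 < β) :
    ∃ K₀ c : ℝ, 1 ≤ K₀ ∧ 0 < c ∧
      ∀ K : ℝ, K₀ ≤ K →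
      ∀ n : ℕ, 0 < n →
      ∀ phat : (Fin n → Euc d) → Measure (Euc d),
        (∀ ω, IsProbabilityMeasure (phat ω)) →
        (∀ ω, Integrable (fun x : Euc d => ‖x‖) (phat ω)) →
        (∀ p : Euc d → ℝ, Assumption1 d β K p →
          Measurable (fun ω : Fin n → Euc d =>
            W1 (volume.withDensity fun x => ENNReal.ofReal (p x)) (phat ω))) →
        ∃ p : Euc d → ℝ, Assumption1 d β K p ∧
          ENNReal.ofReal (c * (n : ℝ) ^ (-(β + 1) / (2 * β + d))) ≤
            ∫⁻ ω, ENNReal.ofReal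
                (W1 (volume.withDensity fun x => ENNReal.ofReal (p x)) (phat ω))
              ∂(Measure.pi fun _ : Fin n =>
                  volume.withDensity fun x => ENNReal.ofReal (p x)) := by
  obtain ⟨φ, p1, p2, p3, p4, p5⟩ := exists_phi d (by omega)
  have hφ : PhiOK φ := ⟨p1, p2, p3, p4, p5⟩
  obtain ⟨K₀, hK₀, hA1⟩ := exists_K0 hφ β hβ
  obtain ⟨L0, hL0, -, hLip0⟩ := holder_of_bdd φ hφ.smooth univ convex_univ
    (bdd_univ _ hφ.smooth hφ.supp) 1 zero_le_one le_rfl 0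
  set L := L0 + 1
  have hL : 0 < L := by positivity
  have hLip : ∀ x y, ‖iteratedFDeriv ℝ 0 φ x - iteratedFDeriv ℝ 0 φ y‖ ≤
      L * ‖x - y‖ ^ (1 : ℝ) := fun x y =>
    (hLip0 x (mem_univ x) y (mem_univ y)).trans
      (mul_le_mul_of_nonneg_right (by simp [L]) (by positivity))
  set S2 := ∫ x, φ x ^ 2
  have hS2 : 0 < S2 := p5
  have hV := Vol_pos d
  set Ch : ℝ := (exp (-2) * Vol d)⁻¹ * S2 with hCh
  have hChp : 0 < Ch := mul_pos (inv_pos.2 (mul_pos (exp_pos _) hV)) hS2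
  have hb : 0 < 2 * β + (d : ℝ) := by positivity
  set γ : ℝ := 1 / (2 * β + d) with hγ
  have hγ0 : 0 < γ := by positivity
  set D : ℝ := (2 * Ch) ^ γ + 2 with hD
  have hDp : 0 < D := by positivity
  set c1 : ℝ := 1 / (2 * L) * ((exp 2 * Vol d)⁻¹ * S2) * (1 / 8) with hc1
  have hc1p : 0 < c1 := by
    have : 0 < exp 2 * Vol d := mul_pos (exp_pos _) hV
    positivity
  refine ⟨K₀, c1 * D ^ (-(β + 1)), hK₀, by positivity, ?_⟩
  intro K hK n hn phat h1 h2 h3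
  have hn' : (0 : ℝ) < n := by exact_mod_cast hn
  have hn1 : (1 : ℝ) ≤ n := by exact_mod_cast hn
  set N : ℕ := ⌈(2 * Ch * n) ^ γ⌉₊ + 1 with hNdef
  have hN : 0 < N := Nat.succ_pos _
  have hN' : (0 : ℝ) < N := by exact_mod_cast hN
  have hN1 : (1 : ℝ) ≤ N := by exact_mod_cast hN
  have hNlow : (2 * Ch * n) ^ γ ≤ N := by
    have := Nat.le_ceil ((2 * Ch * n) ^ γ)
    rw [hNdef]; push_cast; linarith
  have hNup : (N : ℝ) ≤ D * (n : ℝ) ^ γ := by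
    have h4 := (Nat.ceil_lt_add_one (a := (2 * Ch * n) ^ γ) (by positivity)).le
    have h5 : 1 ≤ (n : ℝ) ^ γ := one_le_rpow hn1 hγ0.le
    rw [mul_rpow (by positivity) hn'.le] at h4
    rw [hNdef, mul_rpow (by positivity) hn'.le]; push_cast
    rw [hD]; linarith
  set t := (N : ℝ) ^ (-β) with htdef
  have ht : 0 ≤ t := by positivity
  have htp : 0 < t := by positivity
  have ht1 : t ≤ 1 := rpow_le_one_of_one_le_of_nonpos hN1 (by linarith)
  have hZp := Zc_pos hφ t ht ht1
  have hZb := Zc_bounds hφ t ht ht1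
  have hpow : 2 * Ch * n ≤ (N : ℝ) ^ (2 * β + d) := by
    calc 2 * Ch * n = ((2 * Ch * n) ^ γ) ^ (2 * β + d) := by
          rw [← rpow_mul (by positivity), hγ, one_div_mul_cancel hb.ne', rpow_one]
      _ ≤ _ := rpow_le_rpow (by positivity) hNlow hb.le
  have htN : t ^ 2 * ((N : ℝ) ^ d)⁻¹ = ((N : ℝ) ^ (2 * β + d))⁻¹ := by
    rw [htdef, ← rpow_natCast (N : ℝ) d, ← rpow_natCast _ 2, ← rpow_mul hN'.le, ← rpow_neg hN'.le,
      ← rpow_neg hN'.le, ← rpow_add hN']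
    congr 1; push_cast; ring
  have hδ : n * (((Zc φ t)⁻¹ * t ^ 2) * (((N : ℝ) ^ d)⁻¹ * ∫ x, φ x ^ 2)) ≤ 1 / 2 := by
    have e : n * (((Zc φ t)⁻¹ * t ^ 2) * (((N : ℝ) ^ d)⁻¹ * ∫ x, φ x ^ 2)) =
        n * ((Zc φ t)⁻¹ * S2) * (t ^ 2 * ((N : ℝ) ^ d)⁻¹) := by ring
    rw [e, htN]
    have h6 : (Zc φ t)⁻¹ * S2 ≤ Ch :=
      mul_le_mul_of_nonneg_right (inv_anti₀ (mul_pos (exp_pos _) hV) hZb.1) hS2.le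
    have hp : 0 < (N : ℝ) ^ (2 * β + d) := by positivity
    rw [← div_eq_mul_inv, div_le_iff₀ hp]
    have := mul_le_mul_of_nonneg_left h6 hn'.le
    linarith
  obtain ⟨σ, hσ⟩ := lower_N hφ L hL hLip N hN t ht ht1 n hn hδ phat h1 h2
    (fun σ => h3 _ (hA1 K hK N hN σ))
  refine ⟨pD φ N t σ, hA1 K hK N hN σ, le_trans (ENNReal.ofReal_le_ofReal ?_) hσ⟩
  have hstep : c1 * (N : ℝ) ^ (-(β + 1)) ≤
      1 / (2 * L * N) * ((Zc φ t)⁻¹ * Aint φ t) * (1 / 8) := by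
    have e1 : (N : ℝ) ^ (-(β + 1)) = t * (N : ℝ)⁻¹ := by
      rw [htdef, ← rpow_neg_one (N : ℝ), ← rpow_add hN']; congr 1; ring
    have hA := Aint_ge hφ t ht
    have hinv : (exp 2 * Vol d)⁻¹ ≤ (Zc φ t)⁻¹ := inv_anti₀ hZp hZb.2
    have h7 : (exp 2 * Vol d)⁻¹ * (t * S2) ≤ (Zc φ t)⁻¹ * Aint φ t :=
      mul_le_mul hinv hA (by positivity) (inv_nonneg.2 hZp.le)
    calc c1 * (N : ℝ) ^ (-(β + 1))
        = 1 / (2 * L * N) * ((exp 2 * Vol d)⁻¹ * (t * S2)) * (1 / 8) := by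
          rw [e1, hc1]; field_simp
      _ ≤ _ := by gcongr
  refine le_trans ?_ hstep
  rw [mul_assoc]
  refine mul_le_mul_of_nonneg_left ?_ hc1p.le
  have e2 : (n : ℝ) ^ (-(β + 1) / (2 * β + d)) = ((n : ℝ) ^ γ) ^ (-(β + 1)) := by
    rw [← rpow_mul hn'.le, hγ]; congr 1; ring
  rw [e2, ← mul_rpow hDp.le (by positivity)]
  exact rpow_le_rpow_of_nonpos hN' hNup (by linarith)

end
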